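/- Let d ≥ 1 be an integer, 1 ≤ p < ∞, 1 ≤ v < ∞ with d < 2v. Suppose there is a constant c > 0 such that for every n ∈ ℕ the prior concentrations satisfy α_{j,b_n} ≥ 0 for all j ∈ {1,…,b_n}^d and Σ_{j ∈ {1,…,b_n}^d} α_{j,b_n} ≤ c·n^{1/2}. Then there exist a constant C > 0 (depending only on d, v, p, c) and N ∈ ℕ such that for every n ≥ N, every Borel probability measure P₀ on [0,1)^d, and Y₁,…,Y_n i.i.d. with law P₀, the expectation over the sample satisfies E[W_v(P₀, P̄_n)] ≤ C·n^{-1/(2v)}. -/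

import Mathlib

open MeasureTheory Filter
open scoped ENNReal NNReal Classical BigOperators

noncomputable section

/-- ℓ^p distance on ℝ^d. -/
def lpDist (p : ℝ) {d : ℕ} (x y : Fin d → ℝ) : ℝ :=
  (∑ l, |x l - y l| ^ p) ^ (1 / p)

/-- Wasserstein-v distance with respect to the ℓ^p metric, via couplings. -/
def wassersteinLp (p v : ℝ) {d : ℕ} (μ ν : Measure (Fin d → ℝ)) : ℝ :=
  sInf { r : ℝ | ∃ π : Measure ((Fin d → ℝ) × (Fin d → ℝ)),
      IsProbabilityMeasure π ∧ π.map Prod.fst = μ ∧ π.map Prod.snd = ν ∧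
      r = ∫ z, lpDist p z.1 z.2 ^ v ∂π } ^ (1 / v)

/-- The cube [0,1)^d. -/
def cube (d : ℕ) : Set (Fin d → ℝ) := {x | ∀ l, 0 ≤ x l ∧ x l < 1}

/-- The bin A_{i,b} (0-indexed): ∏_l [i_l/b, (i_l+1)/b). -/
def binSet (d b : ℕ) (i : Fin d → Fin b) : Set (Fin d → ℝ) :=
  {x | ∀ l, (i l : ℝ) / b ≤ x l ∧ x l < ((i l : ℝ) + 1) / b}

/-- Histogram probability measure with weights `w`: density Σ_i b^d w_i 1_{A_{i,b}}. -/
def histMeasure (d b : ℕ) (w : (Fin d → Fin b) → ℝ) : Measure (Fin d → ℝ) :=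
  volume.withDensity fun x =>
    ENNReal.ofReal (∑ i, (b : ℝ) ^ d * w i * Set.indicator (binSet d b i) 1 x)

/-- k_n = n^{1/(2v)} if d ≤ 2v, else n^{1/d}. -/
def kSeq (d : ℕ) (v : ℝ) (n : ℕ) : ℝ :=
  if (d : ℝ) ≤ 2 * v then (n : ℝ) ^ ((1 : ℝ) / (2 * v)) else (n : ℝ) ^ ((1 : ℝ) / d)

/-- K_n = ⌈log₂ k_n⌉. -/
def KSeq (d : ℕ) (v : ℝ) (n : ℕ) : ℕ := ⌈Real.logb 2 (kSeq d v n)⌉₊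

/-- b_n = 2^{K_n}. -/
def bSeq (d : ℕ) (v : ℝ) (n : ℕ) : ℕ := 2 ^ KSeq d v n

/-- Bin count N_j. -/
def binCount (d b : ℕ) {n : ℕ} (Y : Fin n → Fin d → ℝ) (j : Fin d → Fin b) : ℕ :=
  (Finset.univ.filter fun t => Y t ∈ binSet d b j).card

/-- Posterior mean weights π̂_j = (α_j + N_j)/(n + Σ_i α_i). -/
def postWeight (d b : ℕ) {n : ℕ} (α : (Fin d → Fin b) → ℝ) (Y : Fin n → Fin d → ℝ)
    (j : Fin d → Fin b) : ℝ :=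
  (α j + binCount d b Y j) / (n + ∑ i, α i)

/-- The posterior mean histogram P̄_n. -/
def postMeanHist (d : ℕ) (v : ℝ) {n : ℕ} (α : (Fin d → Fin (bSeq d v n)) → ℝ)
    (Y : Fin n → Fin d → ℝ) : Measure (Fin d → ℝ) :=
  histMeasure d (bSeq d v n) (postWeight d (bSeq d v n) α Y)

/-- Dirichlet(β) as the law of normalized independent Gammas. -/
def dirichlet {ι : Type*} [Fintype ι] (β : ι → ℝ) : Measure (ι → ℝ) :=
  (Measure.pi fun i => ProbabilityTheory.gammaMeasure (β i) 1).map
    fun g i => g i / ∑ j, g j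

lemma exists_partial_coupling {X : Type*} [MeasurableSpace X] (μ ν : Measure X)
    [IsFiniteMeasure μ] [IsFiniteMeasure ν] :
    ∃ (π : Measure (X × X)) (μ' ν' : Measure X),
      π.fst + μ' = μ ∧ π.snd + ν' = ν ∧ μ' Set.univ = μ Set.univ - ν Set.univ := by
  set a := μ Set.univ with ha
  set b := ν Set.univ with hb
  set m := (max a b)⁻¹ with hm
  have key : ∀ {t : ℝ≥0∞}, t ≤ max a b → m * t ≤ 1 := by
    intro t h
    calc m * t ≤ (max a b)⁻¹ * max a b := by gcongr
      _ ≤ 1 := ENNReal.inv_mul_le_one _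
  have hma : m * a ≤ 1 := key (le_max_left _ _)
  have hmb : m * b ≤ 1 := key (le_max_right _ _)
  refine ⟨m • μ.prod ν, (1 - m * b) • μ, (1 - m * a) • ν, ?_, ?_, ?_⟩
  · rw [Measure.fst, Measure.map_smul, Measure.map_fst_prod, smul_smul, ← add_smul,
      add_tsub_cancel_of_le hmb, one_smul]
  · rw [Measure.snd, Measure.map_smul, Measure.map_snd_prod, smul_smul, ← add_smul,
      add_tsub_cancel_of_le hma, one_smul]
  · rw [Measure.smul_apply, smul_eq_mul, ← ha]
    rcases le_or_gt a b with hab | hab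
    · rw [tsub_eq_zero_of_le hab]
      rcases eq_or_ne b 0 with h0 | h0
      · rw [show a = 0 by simpa [h0] using hab, mul_zero]
      · rw [hm, max_eq_right hab, ENNReal.inv_mul_cancel h0 (measure_ne_top _ _), tsub_self,
          zero_mul]
    · have h0 : a ≠ 0 := (bot_le.trans_lt hab).ne'
      have ht : a ≠ ∞ := measure_ne_top _ _
      rw [ENNReal.sub_mul (fun _ _ => ht), one_mul, hm, max_eq_left hab.le, mul_right_comm,
        ENNReal.inv_mul_cancel h0 ht, one_mul]

lemma sum_restrict_preimage_singleton {X ι : Type*} [MeasurableSpace X] [Fintype ι] {f : X → ι}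
    (hf : ∀ i, MeasurableSet (f ⁻¹' {i})) (μ : Measure X) :
    ∑ i, μ.restrict (f ⁻¹' {i}) = μ := by
  have h : (⋃ i, f ⁻¹' {i}) = Set.univ := by ext x; simp
  rw [← Measure.sum_fintype, ← Measure.restrict_iUnion _ hf, h, Measure.restrict_univ]
  intro i j hij
  exact Set.disjoint_left.2 fun x hx hy => hij (by simp_all)

lemma exists_cellwise_partial_coupling {X ι : Type*} [MeasurableSpace X] [Fintype ι] {f : X → ι}
    (hf : ∀ i, MeasurableSet (f ⁻¹' {i})) (μ ν : Measure X)
    [IsFiniteMeasure μ] [IsFiniteMeasure ν] :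
    ∃ (π : Measure (X × X)) (μ' ν' : Measure X),
      π.fst + μ' = μ ∧ π.snd + ν' = ν ∧ (∀ᵐ z ∂π, f z.1 = f z.2) ∧
      μ' Set.univ = ∑ i, (μ (f ⁻¹' {i}) - ν (f ⁻¹' {i})) := by
  choose π μ' ν' h1 h2 h3 using fun i =>
    exists_partial_coupling (μ.restrict (f ⁻¹' {i})) (ν.restrict (f ⁻¹' {i}))
  refine ⟨∑ i, π i, ∑ i, μ' i, ∑ i, ν' i, ?_, ?_, ?_, ?_⟩
  · rw [Measure.fst, ← Measure.mapₗ_apply_of_measurable measurable_fst, map_sum,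
      ← Finset.sum_add_distrib]
    simp_rw [Measure.mapₗ_apply_of_measurable measurable_fst]
    rw [← sum_restrict_preimage_singleton hf μ]
    exact Finset.sum_congr rfl fun i _ => h1 i
  · rw [Measure.snd, ← Measure.mapₗ_apply_of_measurable measurable_snd, map_sum,
      ← Finset.sum_add_distrib]
    simp_rw [Measure.mapₗ_apply_of_measurable measurable_snd]
    rw [← sum_restrict_preimage_singleton hf ν]
    exact Finset.sum_congr rfl fun i _ => h2 i
  · rw [← Measure.sum_fintype, Measure.ae_sum_iff]
    intro i
    have e1 : ∀ᵐ x ∂(π i).fst, f x = i :=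
      ae_mono ((Measure.le_add_right le_rfl).trans (h1 i).le)
        (ae_restrict_mem (hf i))
    have e2 : ∀ᵐ x ∂(π i).snd, f x = i :=
      ae_mono ((Measure.le_add_right le_rfl).trans (h2 i).le)
        (ae_restrict_mem (hf i))
    filter_upwards [ae_of_ae_map measurable_fst.aemeasurable e1,
      ae_of_ae_map measurable_snd.aemeasurable e2] with z hz1 hz2
    rw [hz1, hz2]
  · rw [Measure.finsetSum_apply]
    refine Finset.sum_congr rfl fun i _ => ?_
    simp [h3 i]

/-- Greedy multiscale coupling along nested partitions given by labels `f 0, …, f K`,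
from fine to coarse. -/
lemma exists_multiscale_coupling {X : Type*} [MeasurableSpace X] {ι : ℕ → Type*}
    [∀ k, Fintype (ι k)] {f : ∀ k, X → ι k} (hf : ∀ k i, MeasurableSet (f k ⁻¹' {i}))
    (hf0 : ∀ x y, f 0 x = f 0 y) (hnest : ∀ k x y, f (k + 1) x = f (k + 1) y → f k x = f k y)
    (cost : X × X → ℝ≥0∞) (D : ℕ → ℝ≥0∞) (hcost : ∀ k z, f k z.1 = f k z.2 → cost z ≤ D k)
    (K : ℕ) (μ ν : Measure X) [IsFiniteMeasure μ] [IsFiniteMeasure ν]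
    (hμν : μ Set.univ = ν Set.univ) :
    ∃ π : Measure (X × X), π.fst = μ ∧ π.snd = ν ∧
      ∫⁻ z, cost z ∂π ≤ D K * μ Set.univ +
        ∑ j ∈ Finset.range K, D j *
          ∑ i, (μ (f (j + 1) ⁻¹' {i}) - ν (f (j + 1) ⁻¹' {i})) := by
  have hle : ∀ (K : ℕ) (π : Measure (X × X)) (μ μ' : Measure X), π.fst + μ' = μ →
      (∀ᵐ z ∂π, f K z.1 = f K z.2) → ∫⁻ z, cost z ∂π ≤ D K * μ Set.univ := by
    intro K π μ μ' h1 h3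
    calc ∫⁻ z, cost z ∂π ≤ ∫⁻ _, D K ∂π := lintegral_mono_ae (h3.mono fun z hz => hcost K z hz)
      _ = D K * π.fst Set.univ := by rw [lintegral_const, Measure.fst_univ]
      _ ≤ D K * μ Set.univ := by gcongr; exact (Measure.le_add_right le_rfl).trans h1.le
  induction K generalizing μ ν with
  | zero =>
    obtain ⟨π, μ', ν', h1, h2, h3, h4⟩ := exists_cellwise_partial_coupling (hf 0) μ ν
    have hμ' : μ' = 0 := by
      rw [← Measure.measure_univ_eq_zero, h4]
      refine Finset.sum_eq_zero fun i _ => ?_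
      by_cases hi : ∃ x, f 0 x = i
      · obtain ⟨x, rfl⟩ := hi
        have : f 0 ⁻¹' {f 0 x} = Set.univ := by ext y; simp [hf0 y x]
        rw [this, hμν, tsub_self]
      · have : f 0 ⁻¹' {i} = ∅ := by
          ext y; simpa using fun h => hi ⟨y, h⟩
        simp [this]
    have hν' : ν' = 0 := by
      have e1 := congrArg (fun m : Measure X => m Set.univ) h1
      have e2 := congrArg (fun m : Measure X => m Set.univ) h2
      simp only [Measure.add_apply, Measure.fst_univ, Measure.snd_univ, hμ'] at e1 e2
      rw [← Measure.measure_univ_eq_zero]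
      have : π Set.univ + ν' Set.univ = π Set.univ + 0 := by
        rw [e2, ← hμν, ← e1]; simp
      refine (ENNReal.add_right_inj ?_).1 this
      rw [← Measure.fst_univ]
      have hle : π.fst ≤ μ := (Measure.le_add_right le_rfl).trans h1.le
      exact ((hle _).trans_lt (measure_lt_top _ _)).ne
    refine ⟨π, by simpa [hμ'] using h1, by simpa [hν'] using h2, ?_⟩
    simpa using hle 0 π μ μ' h1 h3
  | succ K ih =>
    obtain ⟨π, μ', ν', h1, h2, h3, h4⟩ := exists_cellwise_partial_coupling (hf (K + 1)) μ ν
    have hπμ : π.fst ≤ μ := (Measure.le_add_right le_rfl).trans h1.le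
    have hμ'μ : μ' ≤ μ := (Measure.le_add_left le_rfl).trans h1.le
    have hν'ν : ν' ≤ ν := (Measure.le_add_left le_rfl).trans h2.le
    have := isFiniteMeasure_of_le μ hμ'μ
    have := isFiniteMeasure_of_le ν hν'ν
    have hπtop : ∀ s, π.fst s ≠ ∞ := fun s => ((hπμ s).trans_lt (measure_lt_top _ _)).ne
    have hμs : ∀ s, μ s = π.fst s + μ' s := fun s => by rw [← h1, Measure.add_apply]
    have hνs : ∀ s, ν s = π.snd s + ν' s := fun s => by rw [← h2, Measure.add_apply]
    have hbal : μ' Set.univ = ν' Set.univ := by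
      have := hμν
      rw [hμs, hνs, Measure.fst_univ, Measure.snd_univ] at this
      exact (ENNReal.add_right_inj (by rw [← Measure.fst_univ]; exact hπtop _)).1 this
    have hall : ∀ j ≤ K + 1, ∀ᵐ z ∂π, f j z.1 = f j z.2 := by
      intro j hj
      induction hj using Nat.decreasingInduction with
      | self => exact h3
      | of_succ k _ ih => exact ih.mono fun z hz => hnest _ _ _ hz
    have hdiff : ∀ j ≤ K + 1, ∀ i, μ' (f j ⁻¹' {i}) - ν' (f j ⁻¹' {i}) =
        μ (f j ⁻¹' {i}) - ν (f j ⁻¹' {i}) := by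
      intro j hj i
      have : π.fst (f j ⁻¹' {i}) = π.snd (f j ⁻¹' {i}) := by
        rw [Measure.fst_apply (hf j i), Measure.snd_apply (hf j i)]
        refine measure_congr ((hall j hj).mono fun z hz => ?_)
        simp only [eq_iff_iff]
        change f j z.1 = i ↔ f j z.2 = i
        rw [hz]
      rw [hμs, hνs, ← this, ENNReal.add_sub_add_eq_sub_left (hπtop _)]
    obtain ⟨π', g1, g2, g3⟩ := ih μ' ν' hbal
    refine ⟨π + π', ?_, ?_, ?_⟩
    · rw [← h1, ← g1, Measure.fst, Measure.map_add _ _ measurable_fst]; rfl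
    · rw [← h2, ← g2, Measure.snd, Measure.map_add _ _ measurable_snd]; rfl
    · rw [lintegral_add_measure, Finset.sum_range_succ, add_comm (Finset.sum _ _), ← h4]
      refine add_le_add (hle _ π μ μ' h1 h3) (g3.trans (add_le_add le_rfl ?_))
      refine Finset.sum_le_sum fun j hj => ?_
      have hj' : j + 1 ≤ K + 1 := by have := Finset.mem_range.1 hj; omega
      simp_rw [hdiff (j + 1) hj']; exact le_rfl

/-- Label of the dyadic cell of side `2⁻ᵏ` containing `x`, clamped outside the unit cube. -/
def dyadicCell (d k : ℕ) (x : Fin d → ℝ) : Fin d → Fin (2 ^ k) := fun l =>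
  ⟨min ⌊(2 : ℝ) ^ k * x l⌋₊ (2 ^ k - 1), by have := Nat.two_pow_pos k; omega⟩

lemma measurableSet_dyadicCell_preimage (d k : ℕ) (a : Fin d → Fin (2 ^ k)) :
    MeasurableSet (dyadicCell d k ⁻¹' {a}) := by
  have h : dyadicCell d k ⁻¹' {a} =
      ⋂ l, {x | min ⌊(2 : ℝ) ^ k * x l⌋₊ (2 ^ k - 1) = a l} := by
    ext x
    simp [dyadicCell, funext_iff, Fin.ext_iff]
  rw [h]
  refine MeasurableSet.iInter fun l => ?_
  have hm : Measurable fun x : Fin d → ℝ => min ⌊(2 : ℝ) ^ k * x l⌋₊ (2 ^ k - 1) :=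
    (Nat.measurable_floor.comp (by fun_prop)).min measurable_const
  exact hm (measurableSet_singleton _)

lemma dyadicCell_eq_of_succ {d k : ℕ} {x y : Fin d → ℝ}
    (h : dyadicCell d (k + 1) x = dyadicCell d (k + 1) y) :
    dyadicCell d k x = dyadicCell d k y := by
  have hfl : ∀ t : ℝ, ⌊(2 : ℝ) ^ k * t⌋₊ = ⌊(2 : ℝ) ^ (k + 1) * t⌋₊ / 2 := by
    intro t
    rw [← Nat.floor_div_natCast]
    congr 1
    push_cast
    ring
  funext l
  have hl := congrArg Fin.val (congrFun h l)
  simp only [dyadicCell, pow_succ (2 : ℕ) k] at hl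
  apply Fin.ext
  simp only [dyadicCell, hfl]
  have := Nat.two_pow_pos k
  omega

lemma dyadicCell_eq_of_le {d k K : ℕ} (hk : k ≤ K) {x y : Fin d → ℝ}
    (h : dyadicCell d K x = dyadicCell d K y) : dyadicCell d k x = dyadicCell d k y := by
  induction hk using Nat.decreasingInduction with
  | self => exact h
  | of_succ k _ ih => exact dyadicCell_eq_of_succ ih

lemma binSet_subset_cube {d b : ℕ} (i : Fin d → Fin b) : binSet d b i ⊆ cube d := by
  intro x hx l
  have hb : (0 : ℝ) < b := by exact_mod_cast (i l).pos
  have hi : ((i l : ℕ) : ℝ) + 1 ≤ b := by exact_mod_cast (i l).isLt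
  exact ⟨le_trans (by positivity) (hx l).1,
    (hx l).2.trans_le ((div_le_one hb).2 hi)⟩

lemma mem_binSet_iff_dyadicCell_eq {d k : ℕ} {x : Fin d → ℝ} (hx : x ∈ cube d)
    (i : Fin d → Fin (2 ^ k)) : x ∈ binSet d (2 ^ k) i ↔ dyadicCell d k x = i := by
  simp only [binSet, Set.mem_ofPred_eq, funext_iff, Fin.ext_iff, dyadicCell]
  refine forall_congr' fun l => ?_
  have h2 : (0 : ℝ) < 2 ^ k := by positivity
  have hlt : ⌊(2 : ℝ) ^ k * x l⌋₊ < 2 ^ k := by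
    rw [Nat.floor_lt (mul_nonneg h2.le (hx l).1)]
    push_cast
    nlinarith [(hx l).2]
  rw [min_eq_left (by omega), Nat.floor_eq_iff (mul_nonneg h2.le (hx l).1)]
  push_cast
  rw [div_le_iff₀ h2, lt_div_iff₀ h2, mul_comm (x l)]

lemma abs_sub_le_of_mem_binSet {d b : ℕ} {i : Fin d → Fin b} {x y : Fin d → ℝ}
    (hx : x ∈ binSet d b i) (hy : y ∈ binSet d b i) (l : Fin d) : |x l - y l| ≤ (b : ℝ)⁻¹ := by
  have h1 := hx l
  have h2 := hy l
  rw [add_div, one_div] at h1 h2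
  rw [abs_le]
  constructor <;> linarith

lemma lpDist_rpow_le_of_dyadicCell_eq {d k : ℕ} {p v : ℝ} (hp : 0 < p) (hv : 0 ≤ v)
    {x y : Fin d → ℝ} (hx : x ∈ cube d) (hy : y ∈ cube d)
    (h : dyadicCell d k x = dyadicCell d k y) :
    lpDist p x y ^ v ≤ (d : ℝ) ^ (v / p) * ((2 : ℝ) ^ (-v)) ^ k := by
  have hxb := (mem_binSet_iff_dyadicCell_eq hx _).2 h
  have hyb := (mem_binSet_iff_dyadicCell_eq hy (dyadicCell d k y)).2 rfl
  have hs : ∑ l, |x l - y l| ^ p ≤ d * ((2 : ℝ)⁻¹ ^ k) ^ p := by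
    calc ∑ l, |x l - y l| ^ p ≤ ∑ _l : Fin d, ((2 : ℝ)⁻¹ ^ k) ^ p := by
          refine Finset.sum_le_sum fun l _ => Real.rpow_le_rpow (abs_nonneg _) ?_ hp.le
          simpa using abs_sub_le_of_mem_binSet hxb hyb l
      _ = d * ((2 : ℝ)⁻¹ ^ k) ^ p := by simp
  have h0 : 0 ≤ ∑ l, |x l - y l| ^ p :=
    Finset.sum_nonneg fun l _ => Real.rpow_nonneg (abs_nonneg _) _
  rw [lpDist, ← Real.rpow_mul h0, one_div_mul_eq_div]
  refine (Real.rpow_le_rpow h0 hs (by positivity)).trans_eq ?_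
  rw [Real.mul_rpow (by positivity) (by positivity), ← Real.rpow_mul (by positivity),
    mul_div_cancel₀ _ hp.ne', ← Real.rpow_natCast, ← Real.rpow_mul (by positivity), mul_comm (k : ℝ),
    Real.rpow_mul (by positivity), Real.rpow_natCast, Real.inv_rpow (by positivity),
    Real.rpow_neg (by positivity)]

lemma binSet_eq_pi (d b : ℕ) (i : Fin d → Fin b) :
    binSet d b i =
      Set.univ.pi fun l => Set.Ico ((i l : ℝ) / b) (((i l : ℝ) + 1) / b) := by
  ext x
  simp [binSet, Set.mem_pi]

lemma measurableSet_binSet (d b : ℕ) (i : Fin d → Fin b) : MeasurableSet (binSet d b i) := by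
  rw [binSet_eq_pi]
  exact MeasurableSet.univ_pi fun _ => measurableSet_Ico

lemma measurableSet_cube (d : ℕ) : MeasurableSet (cube d) := by
  have : cube d = Set.univ.pi fun _ => Set.Ico (0 : ℝ) 1 := by
    ext x
    simp [cube, Set.mem_pi]
  rw [this]
  exact MeasurableSet.univ_pi fun _ => measurableSet_Ico

lemma ofReal_pow_mul_volume_binSet {d b : ℕ} (hb : 0 < b) (i : Fin d → Fin b) :
    ENNReal.ofReal ((b : ℝ) ^ d) * volume (binSet d b i) = 1 := by
  have hb' : (0 : ℝ) < b := by exact_mod_cast hb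
  rw [binSet_eq_pi, Real.volume_pi_Ico]
  have : ∀ l, ((i l : ℝ) + 1) / b - (i l : ℝ) / b = (b : ℝ)⁻¹ := fun l => by
    rw [add_div, one_div]; ring
  simp only [this, Finset.prod_const, Finset.card_univ, Fintype.card_fin]
  rw [← ENNReal.ofReal_pow (by positivity), ← ENNReal.ofReal_mul (by positivity), ← mul_pow,
    mul_inv_cancel₀ hb'.ne', one_pow, ENNReal.ofReal_one]

lemma histMeasure_apply {d b : ℕ} {w : (Fin d → Fin b) → ℝ} (hw : ∀ i, 0 ≤ w i)
    {s : Set (Fin d → ℝ)} (hs : MeasurableSet s) :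
    histMeasure d b w s = ∑ i, ENNReal.ofReal (w i) *
      (ENNReal.ofReal ((b : ℝ) ^ d) * volume (binSet d b i ∩ s)) := by
  have hpt : ∀ x, ENNReal.ofReal
      (∑ i, (b : ℝ) ^ d * w i * Set.indicator (binSet d b i) (1 : (Fin d → ℝ) → ℝ) x) =
      ∑ i, (binSet d b i).indicator
        (fun _ => ENNReal.ofReal (w i) * ENNReal.ofReal ((b : ℝ) ^ d)) x := by
    intro x
    rw [ENNReal.ofReal_sum_of_nonneg]
    · refine Finset.sum_congr rfl fun i _ => ?_
      by_cases hx : x ∈ binSet d b i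
      · simp [hx, ENNReal.ofReal_mul (hw i), mul_comm _ (w i)]
      · simp [hx]
    · intro i _
      have := hw i
      exact mul_nonneg (by positivity) (Set.indicator_nonneg (fun _ _ => zero_le_one) _)
  rw [histMeasure, withDensity_apply _ hs]
  simp_rw [hpt]
  rw [lintegral_finsetSum _ fun i _ => measurable_const.indicator (measurableSet_binSet d b i)]
  refine Finset.sum_congr rfl fun i _ => ?_
  rw [lintegral_indicator (measurableSet_binSet d b i), setLIntegral_const,
    Measure.restrict_apply (measurableSet_binSet d b i), mul_assoc]

lemma histMeasure_univ {d b : ℕ} (hb : 0 < b) {w : (Fin d → Fin b) → ℝ} (hw : ∀ i, 0 ≤ w i) :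
    histMeasure d b w Set.univ = ENNReal.ofReal (∑ i, w i) := by
  rw [histMeasure_apply hw MeasurableSet.univ, ENNReal.ofReal_sum_of_nonneg fun i _ => hw i]
  simp only [Set.inter_univ, ofReal_pow_mul_volume_binSet hb, mul_one]

lemma histMeasure_compl_cube {d b : ℕ} {w : (Fin d → Fin b) → ℝ} (hw : ∀ i, 0 ≤ w i) :
    histMeasure d b w (cube d)ᶜ = 0 := by
  rw [histMeasure_apply hw (measurableSet_cube d).compl]
  refine Finset.sum_eq_zero fun i _ => ?_
  have : binSet d b i ∩ (cube d)ᶜ = ∅ := by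
    rw [← Set.sdiff_eq, Set.sdiff_eq_empty]
    exact binSet_subset_cube i
  simp [this]

lemma sum_ofReal_le_histMeasure {d b : ℕ} (hb : 0 < b) {w : (Fin d → Fin b) → ℝ}
    (hw : ∀ i, 0 ≤ w i) {s : Set (Fin d → ℝ)} (hs : MeasurableSet s) :
    ∑ i with binSet d b i ⊆ s, ENNReal.ofReal (w i) ≤ histMeasure d b w s := by
  rw [histMeasure_apply hw hs, Finset.sum_filter]
  refine Finset.sum_le_sum fun i _ => ?_
  split_ifs with h
  · rw [Set.inter_eq_left.2 h, ofReal_pow_mul_volume_binSet hb, mul_one]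
  · exact zero_le

lemma sum_binCount {d k n : ℕ} {Y : Fin n → Fin d → ℝ} (hY : ∀ t, Y t ∈ cube d) :
    ∑ i, binCount d (2 ^ k) Y i = n := by
  simp only [binCount, mem_binSet_iff_dyadicCell_eq (hY _)]
  rw [Finset.sum_card_fiberwise_eq_card_filter]
  simp

lemma binCount_le_sum_binCount {d k K n : ℕ} (hk : k ≤ K) {Y : Fin n → Fin d → ℝ}
    (hY : ∀ t, Y t ∈ cube d) (a : Fin d → Fin (2 ^ k)) :
    binCount d (2 ^ k) Y a ≤
      ∑ i with binSet d (2 ^ K) i ⊆ dyadicCell d k ⁻¹' {a}, binCount d (2 ^ K) Y i := by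
  refine le_trans (Finset.card_le_card ?_) Finset.card_biUnion_le
  intro t ht
  simp only [Finset.mem_filter, Finset.mem_univ, true_and,
    mem_binSet_iff_dyadicCell_eq (hY t)] at ht
  simp only [Finset.mem_biUnion, Finset.mem_filter, Finset.mem_univ, true_and]
  refine ⟨dyadicCell d K (Y t), fun z hz => ?_, (mem_binSet_iff_dyadicCell_eq (hY t) _).2 rfl⟩
  have := (mem_binSet_iff_dyadicCell_eq (binSet_subset_cube _ hz) _).1 hz
  rw [Set.mem_preimage, Set.mem_singleton_iff, ← ht]
  exact dyadicCell_eq_of_le hk this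

lemma postWeight_nonneg {d b n : ℕ} {α : (Fin d → Fin b) → ℝ} (hα : ∀ i, 0 ≤ α i)
    (Y : Fin n → Fin d → ℝ) (j : Fin d → Fin b) : 0 ≤ postWeight d b α Y j := by
  have := hα j
  have : 0 ≤ ∑ i, α i := Finset.sum_nonneg fun i _ => hα i
  unfold postWeight
  positivity

lemma sum_postWeight {d k n : ℕ} (hn : 0 < n) {α : (Fin d → Fin (2 ^ k)) → ℝ}
    (hα : ∀ i, 0 ≤ α i) {Y : Fin n → Fin d → ℝ} (hY : ∀ t, Y t ∈ cube d) :
    ∑ j, postWeight d (2 ^ k) α Y j = 1 := by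
  have : 0 ≤ ∑ i, α i := Finset.sum_nonneg fun i _ => hα i
  have hn' : (0 : ℝ) < n := by exact_mod_cast hn
  unfold postWeight
  rw [← Finset.sum_div, Finset.sum_add_distrib, ← Nat.cast_sum, sum_binCount hY, add_comm,
    div_self (by positivity)]

lemma binCount_div_le_histMeasure {d k K n : ℕ} (hk : k ≤ K)
    {α : (Fin d → Fin (2 ^ K)) → ℝ} (hα : ∀ i, 0 ≤ α i) {Y : Fin n → Fin d → ℝ}
    (hY : ∀ t, Y t ∈ cube d) (a : Fin d → Fin (2 ^ k)) :
    ENNReal.ofReal (binCount d (2 ^ k) Y a / (n + ∑ i, α i)) ≤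
      histMeasure d (2 ^ K) (postWeight d (2 ^ K) α Y) (dyadicCell d k ⁻¹' {a}) := by
  have hS : 0 ≤ ∑ i, α i := Finset.sum_nonneg fun i _ => hα i
  refine le_trans ?_ (sum_ofReal_le_histMeasure (Nat.two_pow_pos K) (postWeight_nonneg hα Y)
    (measurableSet_dyadicCell_preimage d k a))
  rw [← ENNReal.ofReal_sum_of_nonneg fun i _ => postWeight_nonneg hα Y i]
  refine ENNReal.ofReal_le_ofReal ?_
  simp only [postWeight]
  rw [← Finset.sum_div]
  gcongr
  refine le_trans (Nat.cast_le.2 (binCount_le_sum_binCount hk hY a)) ?_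
  push_cast
  exact Finset.sum_le_sum fun i _ => le_add_of_nonneg_left (hα i)

lemma lpDist_nonneg (p : ℝ) {d : ℕ} (x y : Fin d → ℝ) : 0 ≤ lpDist p x y :=
  Real.rpow_nonneg (Finset.sum_nonneg fun _ _ => Real.rpow_nonneg (abs_nonneg _) _) _

lemma wassersteinLp_nonneg (p v : ℝ) {d : ℕ} (μ ν : Measure (Fin d → ℝ)) :
    0 ≤ wassersteinLp p v μ ν := by
  refine Real.rpow_nonneg (Real.sInf_nonneg ?_) _
  rintro r ⟨π, -, -, -, rfl⟩
  exact integral_nonneg fun z => Real.rpow_nonneg (lpDist_nonneg _ _ _) _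

lemma wassersteinLp_le_of_coupling {p v B : ℝ} (hv : 0 ≤ v) (hB : 0 ≤ B) {d : ℕ}
    {μ ν : Measure (Fin d → ℝ)} [IsProbabilityMeasure μ]
    {π : Measure ((Fin d → ℝ) × (Fin d → ℝ))} (h1 : π.fst = μ) (h2 : π.snd = ν)
    (h : ∫⁻ z, ENNReal.ofReal (lpDist p z.1 z.2 ^ v) ∂π ≤ ENNReal.ofReal B) :
    wassersteinLp p v μ ν ≤ B ^ (1 / v) := by
  have hπ : IsProbabilityMeasure π := ⟨by rw [← Measure.fst_univ, h1]; exact measure_univ⟩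
  have hnn : ∀ z : (Fin d → ℝ) × (Fin d → ℝ), 0 ≤ lpDist p z.1 z.2 ^ v :=
    fun z => Real.rpow_nonneg (lpDist_nonneg _ _ _) _
  refine Real.rpow_le_rpow (Real.sInf_nonneg ?_) ?_ (by positivity)
  · rintro r ⟨π, -, -, -, rfl⟩
    exact integral_nonneg hnn
  · refine le_trans (csInf_le ?_ ⟨π, hπ, h1, h2, rfl⟩) ?_
    · refine ⟨0, ?_⟩
      rintro r ⟨π, -, -, -, rfl⟩
      exact integral_nonneg hnn
    · rw [integral_eq_lintegral_of_nonneg_ae (ae_of_all _ hnn)]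
      · exact ENNReal.toReal_le_of_le_ofReal hB h
      · refine Measurable.aestronglyMeasurable ?_
        unfold lpDist
        fun_prop

/-- Multiscale bound on the Wasserstein distance between measures on the unit cube. -/
lemma wassersteinLp_le_sum_dyadic {d : ℕ} {p v : ℝ} (hp : 0 < p) (hv : 0 ≤ v) (K : ℕ)
    {μ ν : Measure (Fin d → ℝ)} [IsProbabilityMeasure μ] [IsProbabilityMeasure ν]
    (hμ : μ (cube d)ᶜ = 0) (hν : ν (cube d)ᶜ = 0) {G : ℕ → ℝ} (hG0 : ∀ k, 0 ≤ G k)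
    (hG : ∀ k ≤ K, ∑ a, (μ (dyadicCell d k ⁻¹' {a}) - ν (dyadicCell d k ⁻¹' {a})) ≤
      ENNReal.ofReal (G k)) :
    wassersteinLp p v μ ν ≤ ((d : ℝ) ^ (v / p) * (((2 : ℝ) ^ (-v)) ^ K +
      ∑ j ∈ Finset.range K, ((2 : ℝ) ^ (-v)) ^ j * G (j + 1))) ^ (1 / v) := by
  set M := (d : ℝ) ^ (v / p)
  set q := (2 : ℝ) ^ (-v)
  have hM : 0 ≤ M := by positivity
  have hq : 0 ≤ q := by positivity
  let cost : (Fin d → ℝ) × (Fin d → ℝ) → ℝ≥0∞ := fun z =>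
    if z.1 ∈ cube d ∧ z.2 ∈ cube d then ENNReal.ofReal (lpDist p z.1 z.2 ^ v) else 0
  obtain ⟨π, h1, h2, h3⟩ := exists_multiscale_coupling
    (f := dyadicCell d) (measurableSet_dyadicCell_preimage d)
    (fun x y => Subsingleton.elim (α := Fin d → Fin 1) _ _)
    (fun k x y => dyadicCell_eq_of_succ) cost (fun k => ENNReal.ofReal (M * q ^ k))
    (by
      intro k z hz
      simp only [cost]
      split_ifs with h
      · exact ENNReal.ofReal_le_ofReal (lpDist_rpow_le_of_dyadicCell_eq hp hv h.1 h.2 hz)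
      · exact zero_le)
    K μ ν (by simp)
  have hsum : 0 ≤ ∑ j ∈ Finset.range K, q ^ j * G (j + 1) :=
    Finset.sum_nonneg fun j _ => mul_nonneg (by positivity) (hG0 _)
  refine wassersteinLp_le_of_coupling hv (by positivity) h1 h2 ?_
  have e1 : ∀ᵐ z ∂π, z.1 ∈ cube d :=
    ae_of_ae_map measurable_fst.aemeasurable (by rw [← Measure.fst, h1]; exact hμ)
  have e2 : ∀ᵐ z ∂π, z.2 ∈ cube d :=
    ae_of_ae_map measurable_snd.aemeasurable (by rw [← Measure.snd, h2]; exact hν)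
  calc ∫⁻ z, ENNReal.ofReal (lpDist p z.1 z.2 ^ v) ∂π = ∫⁻ z, cost z ∂π := by
        refine lintegral_congr_ae ?_
        filter_upwards [e1, e2] with z hz1 hz2
        simp [cost, hz1, hz2]
    _ ≤ _ := h3
    _ ≤ ENNReal.ofReal (M * q ^ K) +
        ∑ j ∈ Finset.range K, ENNReal.ofReal (M * q ^ j) * ENNReal.ofReal (G (j + 1)) := by
        rw [measure_univ, mul_one]
        refine add_le_add le_rfl (Finset.sum_le_sum fun j hj => ?_)
        exact mul_le_mul_right (hG _ (Finset.mem_range.1 hj)) _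
    _ = _ := by
        rw [mul_add, ENNReal.ofReal_add (by positivity) (by positivity), Finset.mul_sum,
          ENNReal.ofReal_sum_of_nonneg
            fun j _ => mul_nonneg hM (mul_nonneg (by positivity) (hG0 _))]
        congr 1
        refine Finset.sum_congr rfl fun j _ => ?_
        rw [← ENNReal.ofReal_mul (by positivity), mul_assoc]

lemma sum_measure_sub_histMeasure_le {d k K n : ℕ} (hn : 0 < n) (hk : k ≤ K)
    {α : (Fin d → Fin (2 ^ K)) → ℝ} (hα : ∀ i, 0 ≤ α i) {Y : Fin n → Fin d → ℝ}
    (hY : ∀ t, Y t ∈ cube d) (μ : Measure (Fin d → ℝ)) [IsFiniteMeasure μ] :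
    ∑ a, (μ (dyadicCell d k ⁻¹' {a}) -
        histMeasure d (2 ^ K) (postWeight d (2 ^ K) α Y) (dyadicCell d k ⁻¹' {a})) ≤
      ENNReal.ofReal (∑ a, |μ.real (dyadicCell d k ⁻¹' {a}) - binCount d (2 ^ k) Y a / n| +
        (∑ i, α i) / n) := by
  set S := ∑ i, α i with hSdef
  have hS : 0 ≤ S := Finset.sum_nonneg fun i _ => hα i
  have hn' : (0 : ℝ) < n := by exact_mod_cast hn
  have hterm : ∀ a, μ (dyadicCell d k ⁻¹' {a}) -
      histMeasure d (2 ^ K) (postWeight d (2 ^ K) α Y) (dyadicCell d k ⁻¹' {a}) ≤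
      ENNReal.ofReal (|μ.real (dyadicCell d k ⁻¹' {a}) - binCount d (2 ^ k) Y a / n| +
        binCount d (2 ^ k) Y a * (S / n ^ 2)) := by
    intro a
    refine (tsub_le_tsub_left (binCount_div_le_histMeasure hk hα hY a) _).trans ?_
    rw [← ofReal_measureReal, ← ENNReal.ofReal_sub _ (by positivity)]
    refine ENNReal.ofReal_le_ofReal ?_
    set N : ℝ := (binCount d (2 ^ k) Y a : ℝ)
    have hN : 0 ≤ N := Nat.cast_nonneg _
    have h1 : N / n - N / (n + S) ≤ N * (S / n ^ 2) := by
      have : N / n - N / (n + S) = N * (S / (n * (n + S))) := by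
        field_simp
        ring
      rw [this]
      gcongr
      nlinarith
    linarith [le_abs_self (μ.real (dyadicCell d k ⁻¹' {a}) - N / n)]
  refine (Finset.sum_le_sum fun a _ => hterm a).trans_eq ?_
  rw [← ENNReal.ofReal_sum_of_nonneg fun a _ => by positivity, Finset.sum_add_distrib,
    ← Finset.sum_mul, ← Nat.cast_sum, sum_binCount hY]
  congr 2
  field_simp

lemma integrable_sq_measureReal_sub {X : Type*} [MeasurableSpace X] (μ : Measure X)
    [IsProbabilityMeasure μ] {s : Set X} (hs : MeasurableSet s) (n : ℕ) :
    Integrable (fun Y => (μ.real s - (∑ t, s.indicator 1 (Y t)) / n) ^ 2)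
      (Measure.pi fun _ : Fin n => μ) := by
  have hg : MemLp (s.indicator (1 : X → ℝ)) 2 μ := (memLp_const (1 : ℝ)).indicator hs
  have hsum : MemLp (fun Y => ∑ t, s.indicator (1 : X → ℝ) (Y t)) 2
      (Measure.pi fun _ : Fin n => μ) :=
    memLp_finsetSum _ fun t _ =>
      hg.comp_measurePreserving (measurePreserving_eval (fun _ : Fin n => μ) t)
  refine MemLp.integrable_sq ((memLp_const _).sub ?_)
  simpa only [div_eq_mul_inv] using hsum.mul_const (n : ℝ)⁻¹

lemma integral_sq_measureReal_sub_le {X : Type*} [MeasurableSpace X] (μ : Measure X)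
    [IsProbabilityMeasure μ] {s : Set X} (hs : MeasurableSet s) {n : ℕ} (hn : 0 < n) :
    ∫ Y, (μ.real s - (∑ t, s.indicator 1 (Y t)) / n) ^ 2 ∂(Measure.pi fun _ : Fin n => μ) ≤
      μ.real s / n := by
  have hn' : (0 : ℝ) < n := by exact_mod_cast hn
  let g : X → ℝ := s.indicator 1
  have hgm : Measurable g := measurable_one.indicator hs
  have hg : MemLp g 2 μ := (memLp_const (1 : ℝ)).indicator hs
  have hgi : Integrable g μ := hg.integrable (by norm_num)
  have hint : ∫ x, g x ∂μ = μ.real s := integral_indicator_one hs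
  have hvar : ProbabilityTheory.variance g μ ≤ μ.real s := by
    refine (ProbabilityTheory.variance_le_expectation_sq hgm.aestronglyMeasurable).trans_eq ?_
    rw [← hint]
    refine integral_congr_ae (ae_of_all _ fun x => ?_)
    by_cases hx : x ∈ s <;> simp [g, hx]
  have hmean : ∫ Y, (∑ t, fun Y : Fin n → X => g (Y t)) Y ∂(Measure.pi fun _ : Fin n => μ) =
      n * μ.real s := by
    simp only [Finset.sum_apply]
    rw [integral_finsetSum _ fun t _ => integrable_comp_eval (μ := fun _ : Fin n => μ) hgi]
    have : ∀ t : Fin n, ∫ Y, g (Y t) ∂(Measure.pi fun _ : Fin n => μ) = μ.real s := fun t =>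
      (integral_comp_eval (μ := fun _ : Fin n => μ) hgi.aestronglyMeasurable).trans hint
    simp [this]
  have hsum := ProbabilityTheory.variance_sum_pi (μ := fun _ : Fin n => μ) (X := fun _ => g)
    fun _ => hg
  have hm : Measurable (∑ t, fun Y : Fin n → X => g (Y t)) := by fun_prop
  rw [ProbabilityTheory.variance_eq_integral hm.aemeasurable, hmean] at hsum
  calc _ = ∫ Y, ((n : ℝ) ^ 2)⁻¹ * ((∑ t, fun Y : Fin n → X => g (Y t)) Y - n * μ.real s) ^ 2
        ∂(Measure.pi fun _ : Fin n => μ) := by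
        refine integral_congr_ae (ae_of_all _ fun Y => ?_)
        simp only [Finset.sum_apply, g]
        field_simp
        ring
    _ = ((n : ℝ) ^ 2)⁻¹ * ∑ _t : Fin n, ProbabilityTheory.variance g μ := by
        rw [integral_const_mul, hsum]
    _ ≤ ((n : ℝ) ^ 2)⁻¹ * ∑ _t : Fin n, μ.real s := by gcongr
    _ = μ.real s / n := by
        simp only [Finset.sum_const, Finset.card_univ, Fintype.card_fin, nsmul_eq_mul]
        field_simp

lemma binCount_eq_sum_indicator {d k n : ℕ} {Y : Fin n → Fin d → ℝ} (hY : ∀ t, Y t ∈ cube d)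
    (a : Fin d → Fin (2 ^ k)) :
    (binCount d (2 ^ k) Y a : ℝ) = ∑ t, (dyadicCell d k ⁻¹' {a}).indicator 1 (Y t) := by
  simp only [binCount, mem_binSet_iff_dyadicCell_eq (hY _), Set.indicator_apply, Set.mem_preimage,
    Set.mem_singleton_iff, Pi.one_apply]
  rw [Finset.sum_boole]

lemma abs_le_sq_div_add (x : ℝ) {s : ℝ} (hs : 0 < s) : |x| ≤ x ^ 2 / s + s := by
  have h : |x| * s ≤ x ^ 2 + s ^ 2 := by
    rw [← sq_abs]
    nlinarith [sq_nonneg (|x| - s), abs_nonneg x, sq_nonneg s, sq_nonneg |x|]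
  calc |x| = |x| * s / s := by field_simp
    _ ≤ (x ^ 2 + s ^ 2) / s := by gcongr
    _ = x ^ 2 / s + s := by field_simp

lemma rpow_one_div_le_mul_one_add_div {B ε v : ℝ} (hB : 0 ≤ B) (hε : 0 < ε) (hv : 1 ≤ v) :
    B ^ (1 / v) ≤ ε ^ (1 / v) * (1 + B / ε) := by
  have hBε : 0 ≤ B / ε := by positivity
  have hv' : 0 ≤ 1 / v := by positivity
  calc B ^ (1 / v) = ε ^ (1 / v) * (B / ε) ^ (1 / v) := by
        rw [← Real.mul_rpow hε.le hBε, mul_div_cancel₀ _ hε.ne']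
    _ ≤ ε ^ (1 / v) * (1 + B / ε) ^ (1 : ℝ) := by
        refine mul_le_mul_of_nonneg_left ?_ (by positivity)
        refine (Real.rpow_le_rpow hBε (le_add_of_nonneg_left zero_le_one) hv').trans ?_
        exact Real.rpow_le_rpow_of_exponent_le (by linarith) ((div_le_one (by linarith)).2 hv)
    _ = ε ^ (1 / v) * (1 + B / ε) := by rw [Real.rpow_one]

lemma geom_sum_le_one_div {r : ℝ} (h0 : 0 ≤ r) (h1 : r < 1) (K : ℕ) :
    ∑ j ∈ Finset.range K, r ^ j ≤ 1 / (1 - r) := by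
  rw [one_div, ← tsum_geometric_of_lt_one h0 h1]
  exact (summable_geometric_of_lt_one h0 h1).sum_le_tsum _ fun j _ => by positivity

lemma sum_measureReal_dyadicCell {d k : ℕ} (μ : Measure (Fin d → ℝ)) [IsProbabilityMeasure μ] :
    ∑ a, μ.real (dyadicCell d k ⁻¹' {a}) = 1 := by
  rw [sum_measureReal_preimage_singleton _ fun a _ => measurableSet_dyadicCell_preimage d k a]
  simp

lemma integral_wassersteinLp_histMeasure_le {d K n : ℕ} {p v c : ℝ} (hp : 0 < p) (hv : 1 ≤ v)
    (hdv : (d : ℝ) < 2 * v) (hc : 0 ≤ c) (hn : 0 < n)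
    {α : (Fin d → Fin (2 ^ K)) → ℝ} (hα : ∀ i, 0 ≤ α i)
    (hαsum : ∑ i, α i ≤ c * (n : ℝ) ^ ((1 : ℝ) / 2))
    (hK : ((2 : ℝ) ^ (-v)) ^ K ≤ (n : ℝ) ^ (-((1 : ℝ) / 2)))
    (μ : Measure (Fin d → ℝ)) [IsProbabilityMeasure μ] (hμ : μ (cube d)ᶜ = 0) :
    ∫ Y, wassersteinLp p v μ (histMeasure d (2 ^ K) (postWeight d (2 ^ K) α Y))
        ∂(Measure.pi fun _ : Fin n => μ) ≤
      (1 + (d : ℝ) ^ (v / p) * (1 + 2 * (2 : ℝ) ^ ((d : ℝ) / 2) /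
        (1 - (2 : ℝ) ^ (-v) * (2 : ℝ) ^ ((d : ℝ) / 2)) + c / (1 - (2 : ℝ) ^ (-v)))) *
      (n : ℝ) ^ (-(1 / (2 * v))) := by
  have hn' : (0 : ℝ) < n := by exact_mod_cast hn
  have hq1 : (2 : ℝ) ^ (-v) < 1 := Real.rpow_lt_one_of_one_lt_of_neg one_lt_two (by linarith)
  have hqR1 : (2 : ℝ) ^ (-v) * (2 : ℝ) ^ ((d : ℝ) / 2) < 1 := by
    rw [← Real.rpow_add two_pos]
    exact Real.rpow_lt_one_of_one_lt_of_neg one_lt_two (by linarith)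
  have hRcard : ∀ k : ℕ, ((2 : ℝ) ^ k) ^ d = ((2 : ℝ) ^ ((d : ℝ) / 2)) ^ k *
      ((2 : ℝ) ^ ((d : ℝ) / 2)) ^ k := by
    intro k
    rw [← mul_pow, ← Real.rpow_add two_pos, add_halves, Real.rpow_natCast, pow_right_comm]
  set M := (d : ℝ) ^ (v / p)
  set q := (2 : ℝ) ^ (-v)
  set R := (2 : ℝ) ^ ((d : ℝ) / 2)
  set ε := (n : ℝ) ^ (-((1 : ℝ) / 2)) with hε
  have hM0 : 0 ≤ M := by positivity
  have hq0 : 0 < q := by positivity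
  have hR0 : 0 < R := by positivity
  have hε0 : 0 < ε := by positivity
  have hεsq : ε * ε * n = 1 := by
    rw [hε, ← Real.rpow_add hn', ← Real.rpow_add_one hn'.ne']
    norm_num
  have hSε : (∑ i, α i) / n ≤ c * ε := by
    rw [div_le_iff₀ hn']
    refine hαsum.trans_eq ?_
    rw [mul_assoc, hε, ← Real.rpow_add_one hn'.ne']
    norm_num
  have hεv : ε ^ (1 / v) = (n : ℝ) ^ (-(1 / (2 * v))) := by
    rw [hε, ← Real.rpow_mul hn'.le]
    congr 1
    field_simp
  set ℙ := Measure.pi fun _ : Fin n => μ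
  let s : ℕ → ℝ := fun k => ε / R ^ k
  have hs0 : ∀ k, 0 < s k := fun k => by positivity
  let x : ∀ k : ℕ, (Fin d → Fin (2 ^ k)) → (Fin n → Fin d → ℝ) → ℝ := fun k a Y =>
    μ.real (dyadicCell d k ⁻¹' {a}) - (∑ t, (dyadicCell d k ⁻¹' {a}).indicator 1 (Y t)) / n
  let H : ℕ → (Fin n → Fin d → ℝ) → ℝ := fun k Y =>
    ∑ a, (x k a Y ^ 2 / s k + s k) + c * ε
  have hH0 : ∀ k Y, 0 ≤ H k Y := fun k Y =>
    add_nonneg (Finset.sum_nonneg fun a _ => by have := hs0 k; positivity) (by positivity)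
  have hxint : ∀ k a, Integrable (fun Y => x k a Y ^ 2) ℙ := fun k a =>
    integrable_sq_measureReal_sub μ (measurableSet_dyadicCell_preimage d k a) n
  have hxs : ∀ k a, Integrable (fun Y => x k a Y ^ 2 / s k + s k) ℙ := fun k a =>
    ((hxint k a).div_const _).add (integrable_const _)
  have hHsum : ∀ k, Integrable (fun Y => ∑ a, (x k a Y ^ 2 / s k + s k)) ℙ := fun k =>
    integrable_finsetSum _ fun a _ => hxs k a
  have hHint : ∀ k, Integrable (H k) ℙ := fun k => (hHsum k).add (integrable_const _)
  have hH : ∀ k, ∫ Y, H k Y ∂ℙ ≤ 2 * R ^ k * ε + c * ε := by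
    intro k
    have h1 : ∫ Y, H k Y ∂ℙ = ∑ a, ((∫ Y, x k a Y ^ 2 ∂ℙ) / s k + s k) + c * ε := by
      simp only [H]
      rw [integral_add (hHsum k) (integrable_const _),
        integral_finsetSum _ fun a _ => hxs k a]
      congr 1
      · refine Finset.sum_congr rfl fun a _ => ?_
        rw [integral_add ((hxint k a).div_const _) (integrable_const _), integral_div]
        simp
      · simp
    have h2 : ∑ a, ((∫ Y, x k a Y ^ 2 ∂ℙ) / s k + s k) ≤
        ∑ a, (μ.real (dyadicCell d k ⁻¹' {a}) / n / s k + s k) := by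
      refine Finset.sum_le_sum fun a _ => ?_
      have := hs0 k
      gcongr
      exact integral_sq_measureReal_sub_le μ (measurableSet_dyadicCell_preimage d k a) hn
    have h3 : ∑ a, (μ.real (dyadicCell d k ⁻¹' {a}) / n / s k + s k) = 2 * R ^ k * ε := by
      rw [Finset.sum_add_distrib, ← Finset.sum_div, ← Finset.sum_div, sum_measureReal_dyadicCell]
      simp only [Finset.sum_const, Finset.card_univ, Fintype.card_pi, Fintype.card_fin,
        Finset.prod_const, nsmul_eq_mul, s]
      push_cast
      rw [hRcard k]
      field_simp
      linear_combination (-1 : ℝ) * hεsq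
    linarith
  let B : (Fin n → Fin d → ℝ) → ℝ := fun Y =>
    M * (q ^ K + ∑ j ∈ Finset.range K, q ^ j * H (j + 1) Y)
  have hB0 : ∀ Y, 0 ≤ B Y := fun Y => mul_nonneg hM0 (add_nonneg (by positivity)
    (Finset.sum_nonneg fun j _ => mul_nonneg (by positivity) (hH0 _ _)))
  have hsumint : Integrable (fun Y => ∑ j ∈ Finset.range K, q ^ j * H (j + 1) Y) ℙ :=
    integrable_finsetSum _ fun j _ => (hHint _).const_mul _
  have hBint : Integrable B ℙ := ((integrable_const _).add hsumint).const_mul _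
  have hB : ∫ Y, B Y ∂ℙ ≤ M * (1 + 2 * R / (1 - q * R) + c / (1 - q)) * ε := by
    have h1 : ∫ Y, B Y ∂ℙ =
        M * (q ^ K + ∑ j ∈ Finset.range K, q ^ j * ∫ Y, H (j + 1) Y ∂ℙ) := by
      simp only [B]
      rw [integral_const_mul, integral_add (integrable_const _) hsumint,
        integral_finsetSum _ fun j _ => (hHint _).const_mul _]
      simp [integral_const_mul]
    rw [h1, mul_assoc]
    refine mul_le_mul_of_nonneg_left ?_ hM0
    calc q ^ K + ∑ j ∈ Finset.range K, q ^ j * ∫ Y, H (j + 1) Y ∂ℙ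
        ≤ ε + ∑ j ∈ Finset.range K, q ^ j * (2 * R ^ (j + 1) * ε + c * ε) := by
          gcongr
          exact hH _
      _ = ε + (2 * R * ε * ∑ j ∈ Finset.range K, (q * R) ^ j +
            c * ε * ∑ j ∈ Finset.range K, q ^ j) := by
          rw [Finset.mul_sum, Finset.mul_sum, ← Finset.sum_add_distrib]
          congr 1
          refine Finset.sum_congr rfl fun j _ => ?_
          ring
      _ ≤ ε + (2 * R * ε * (1 / (1 - q * R)) + c * ε * (1 / (1 - q))) := by
          gcongr
          · exact geom_sum_le_one_div (by positivity) hqR1 K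
          · exact geom_sum_le_one_div hq0.le hq1 K
      _ = (1 + 2 * R / (1 - q * R) + c / (1 - q)) * ε := by ring
  have hcube : ∀ᵐ Y ∂ℙ, ∀ t, Y t ∈ cube d := by
    refine ae_all_iff.2 fun t => ?_
    exact (Measure.tendsto_eval_ae_ae (μ := fun _ : Fin n => μ) (i := t)).eventually hμ
  have hW : ∀ᵐ Y ∂ℙ, wassersteinLp p v μ (histMeasure d (2 ^ K) (postWeight d (2 ^ K) α Y)) ≤
      ε ^ (1 / v) * (1 + B Y / ε) := by
    filter_upwards [hcube] with Y hY
    have hw := postWeight_nonneg hα Y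
    have : IsProbabilityMeasure (histMeasure d (2 ^ K) (postWeight d (2 ^ K) α Y)) :=
      ⟨by rw [histMeasure_univ (Nat.two_pow_pos K) hw, sum_postWeight hn hα hY,
        ENNReal.ofReal_one]⟩
    refine (wassersteinLp_le_sum_dyadic hp (by linarith) K hμ (histMeasure_compl_cube hw)
      (G := fun k => H k Y) (fun k => hH0 k Y) fun k hk => ?_).trans
      (rpow_one_div_le_mul_one_add_div (hB0 Y) hε0 hv)
    refine (sum_measure_sub_histMeasure_le hn hk hα hY μ).trans (ENNReal.ofReal_le_ofReal ?_)
    refine add_le_add (Finset.sum_le_sum fun a _ => ?_) hSε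
    rw [binCount_eq_sum_indicator hY]
    exact abs_le_sq_div_add _ (hs0 k)
  have hbd : Integrable (fun Y => ε ^ (1 / v) * (1 + B Y / ε)) ℙ :=
    ((integrable_const _).add (hBint.div_const _)).const_mul _
  refine (integral_mono_of_nonneg (ae_of_all _ fun Y => wassersteinLp_nonneg _ _ _ _)
    hbd hW).trans ?_
  rw [integral_const_mul, integral_add (integrable_const _) (hBint.div_const _), integral_div,
    hεv, mul_comm]
  refine mul_le_mul_of_nonneg_right ?_ (by positivity)
  have := (div_le_iff₀ hε0).2 hB
  simpa using this

lemma two_rpow_neg_pow_KSeq_le {d n : ℕ} {v : ℝ} (hv : 0 < v) (hdv : (d : ℝ) ≤ 2 * v)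
    (hn : 0 < n) : ((2 : ℝ) ^ (-v)) ^ KSeq d v n ≤ (n : ℝ) ^ (-((1 : ℝ) / 2)) := by
  have hn' : (0 : ℝ) < n := by exact_mod_cast hn
  have hk : kSeq d v n = (n : ℝ) ^ ((1 : ℝ) / (2 * v)) := if_pos hdv
  have hk0 : 0 < kSeq d v n := by rw [hk]; positivity
  have h2 : kSeq d v n ≤ (2 : ℝ) ^ KSeq d v n := by
    rw [← Real.rpow_natCast, ← Real.logb_le_iff_le_rpow one_lt_two hk0]
    exact Nat.le_ceil _
  calc ((2 : ℝ) ^ (-v)) ^ KSeq d v n = ((2 : ℝ) ^ KSeq d v n) ^ (-v) := by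
        rw [← Real.rpow_natCast, ← Real.rpow_natCast, ← Real.rpow_mul two_pos.le,
          ← Real.rpow_mul two_pos.le, mul_comm]
    _ ≤ kSeq d v n ^ (-v) := Real.rpow_le_rpow_of_nonpos hk0 h2 (by linarith)
    _ = (n : ℝ) ^ (-((1 : ℝ) / 2)) := by
        rw [hk, ← Real.rpow_mul hn'.le]
        congr 1
        field_simp

/-- For d < 2v, under the prior-mass bound Σ_j α_{j,b_n} ≤ c·n^{1/2}, the posterior
mean histogram attains the rate n^{-1/(2v)} in expected Wasserstein-v loss, uniformly over Borel
probability measures P₀ on [0,1)^d. -/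
theorem bayes_histogram_rate_d_lt_2v
    (d : ℕ) (hd : 1 ≤ d) (p v : ℝ) (hp : 1 ≤ p) (hv : 1 ≤ v) (hdv : (d : ℝ) < 2 * v)
    (α : ∀ n : ℕ, (Fin d → Fin (bSeq d v n)) → ℝ) (c : ℝ) (hc : 0 < c)
    (hα0 : ∀ n j, 0 ≤ α n j)
    (hαsum : ∀ n : ℕ, ∑ j, α n j ≤ c * (n : ℝ) ^ ((1 : ℝ) / 2)) :
    ∃ C > (0 : ℝ), ∃ N : ℕ, ∀ n ≥ N, ∀ P₀ : Measure (Fin d → ℝ),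
      IsProbabilityMeasure P₀ → P₀ (cube d) = 1 →
      ∫ Y, wassersteinLp p v P₀ (postMeanHist d v (α n) Y)
          ∂(Measure.pi fun _ : Fin n => P₀)
        ≤ C * (n : ℝ) ^ (-(1 / (2 * v))) := by
  have hq1 : (2 : ℝ) ^ (-v) < 1 := Real.rpow_lt_one_of_one_lt_of_neg one_lt_two (by linarith)
  have hqR1 : (2 : ℝ) ^ (-v) * (2 : ℝ) ^ ((d : ℝ) / 2) < 1 := by
    rw [← Real.rpow_add two_pos]
    exact Real.rpow_lt_one_of_one_lt_of_neg one_lt_two (by linarith)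
  refine ⟨1 + (d : ℝ) ^ (v / p) * (1 + 2 * (2 : ℝ) ^ ((d : ℝ) / 2) /
    (1 - (2 : ℝ) ^ (-v) * (2 : ℝ) ^ ((d : ℝ) / 2)) + c / (1 - (2 : ℝ) ^ (-v))), ?_, 1, ?_⟩
  · have h1 := sub_pos.2 hq1
    have h2 := sub_pos.2 hqR1
    positivity
  · intro n hn P₀ hP₀ hcube
    exact integral_wassersteinLp_histMeasure_le (K := KSeq d v n) (by linarith) hv hdv hc.le hn
      (hα0 n) (hαsum n) (two_rpow_neg_pow_KSeq_le (by linarith) hdv.le hn) P₀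
      ((prob_compl_eq_zero_iff (measurableSet_cube d)).2 hcube)

end
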